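/- arXiv:2505.03720 — 3 statements merged into one kernel-verified Lean document; each statement's English description precedes it below -/
import Mathlib

section
/- For every integer k ≥ 1 and every odd positive integer m, the negative continued fraction whose entry list consists of (2^k·m − 2) entries equal to 2, followed by one entry equal to 3, followed by 8 entries equal to 2, is equal to (2^k·10m − 1)/(2^k·10m − 11). -/
/-- Negative (Hirzebruch–Jung) continued fraction of a list of rationals:
`ncf [a] = a` and `ncf (a :: l) = a - 1 / ncf l` for nonempty `l`. -/
def ncf : List ℚ → ℚ
  | [] => 0
  | [a] => a
  | a :: b :: l => a - 1 / ncf (b :: l)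

theorem ncf_cons_of_ne_nil (a : ℚ) {l : List ℚ} (hl : l ≠ []) :
    ncf (a :: l) = a - 1 / ncf l := by
  cases l with
  | nil => exact absurd rfl hl
  | cons b l => rfl

theorem ncf_replicate_two_append_three (n : ℕ) :
    ncf (List.replicate n (2 : ℚ) ++ [(3 : ℚ)] ++ List.replicate 8 (2 : ℚ)) =
      (10 * n + 19) / (10 * n + 9) := by
  induction n with
  | zero => norm_num [List.replicate, ncf]
  | succ n ih =>
    rw [List.replicate_succ, List.cons_append, List.cons_append,
      ncf_cons_of_ne_nil _ (by simp), ih]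
    push_cast
    field_simp
    ring

/-- For `k ≥ 1` and odd `m ≥ 1`, the negative continued fraction
`[2, …, 2, 3, 2, …, 2]` with `2^k·m − 2` initial `2`'s and eight final `2`'s
equals `(2^k·10m − 1)/(2^k·10m − 11)`. -/
theorem stmt0 (k m : ℕ) (hk : 1 ≤ k) (hm : 1 ≤ m) (hmodd : Odd m) :
    ncf (List.replicate (2 ^ k * m - 2) (2 : ℚ) ++ [(3 : ℚ)] ++ List.replicate 8 (2 : ℚ)) =
      ((2 : ℚ) ^ k * 10 * m - 1) / ((2 : ℚ) ^ k * 10 * m - 11) := by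
  have hle : 2 ≤ 2 ^ k * m :=
    calc 2 = 2 ^ 1 * 1 := by norm_num
      _ ≤ 2 ^ k * m := Nat.mul_le_mul (Nat.pow_le_pow_right (by norm_num) hk) hm
  rw [ncf_replicate_two_append_three, Nat.cast_sub hle]
  push_cast
  congr 1 <;> ring
end

section
/- Fix integers k ≥ 1 and m ≥ 1 with m odd, and let A = A(k,m) be the plumbing matrix of the graph Γ(k,m) described in the context, of size N = 2 + 2^k·(2^k·m + 7). Then A is negative definite: xᵀAx < 0 for every nonzero vector x ∈ ℝ^N. -/
open scoped Matrix

/-- Vertices of the plumbing graph `Γ(k,m)`: `none` is the central vertex `c`,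
`some none` is the vertex `u`, and `some (some (i, j))` is the vertex `v_{i, j+1}`
on the `i`-th leg (so `j.val + 1` is the label `1, …, 2^k·m + 7`). -/
abbrev PlumbVtx (k m : ℕ) := Option (Option (Fin (2 ^ k) × Fin (2 ^ k * m + 7)))

/-- Adjacency in `Γ(k,m)`: `c` is adjacent to `u` and to each `v_{i,1}`, and
consecutive vertices `v_{i,j}`, `v_{i,j+1}` of each leg are adjacent. -/
def plumbAdj (k m : ℕ) : PlumbVtx k m → PlumbVtx k m → Bool
  | none, some none => true
  | some none, none => true
  | none, some (some (_, j)) => j.val == 0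
  | some (some (_, j)), none => j.val == 0
  | some (some (i, j)), some (some (i', j')) =>
      i == i' && (j.val + 1 == j'.val || j'.val + 1 == j.val)
  | _, _ => false

/-- Weights of `Γ(k,m)`: `wt c = −2^k`, `wt u = −m`, `wt v_{i,j} = −3` if
`j = 2^k·m − 1` and `−2` otherwise. -/
def plumbWt (k m : ℕ) : PlumbVtx k m → ℤ
  | none => -(2 ^ k : ℤ)
  | some none => -(m : ℤ)
  | some (some (_, j)) => if j.val + 2 = 2 ^ k * m then -3 else -2

/-- The plumbing matrix `A(k,m)`: diagonal entries are the weights, off-diagonal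
entries are `1` for adjacent vertices and `0` otherwise. -/
def plumbMat (k m : ℕ) : Matrix (PlumbVtx k m) (PlumbVtx k m) ℤ :=
  Matrix.of fun x y => if x = y then plumbWt k m x else if plumbAdj k m x y then 1 else 0

/-- The quadratic form of a symmetric matrix `B` at `z * f`, as a diagonal part weighted by `B z`
minus a sum over pairs of indices of squared differences of `f`. -/
theorem dotProduct_mulVec_mul_eq {ι : Type*} [Fintype ι] (B : Matrix ι ι ℝ)
    (hB : ∀ i j, B i j = B j i) (z f : ι → ℝ) :
    (z * f) ⬝ᵥ B.mulVec (z * f) =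
      ∑ i, z i * B.mulVec z i * f i ^ 2 -
        (1 / 2) * ∑ i, ∑ j, B i j * z i * z j * (f i - f j) ^ 2 := by
  have hswap : ∑ i, ∑ j, B i j * z i * z j * f j ^ 2 = ∑ i, ∑ j, B i j * z i * z j * f i ^ 2 := by
    rw [Finset.sum_comm]
    refine Finset.sum_congr rfl fun i _ => Finset.sum_congr rfl fun j _ => ?_
    rw [hB j i]; ring
  have hsq : ∑ i, ∑ j, B i j * z i * z j * (f i - f j) ^ 2 =
      ∑ i, ∑ j, B i j * z i * z j * f i ^ 2 + ∑ i, ∑ j, B i j * z i * z j * f j ^ 2 -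
        2 * ∑ i, ∑ j, B i j * z i * z j * f i * f j := by
    simp only [Finset.mul_sum, ← Finset.sum_add_distrib, ← Finset.sum_sub_distrib]
    refine Finset.sum_congr rfl fun i _ => Finset.sum_congr rfl fun j _ => ?_
    ring
  have hdiag : ∑ i, z i * B.mulVec z i * f i ^ 2 = ∑ i, ∑ j, B i j * z i * z j * f i ^ 2 := by
    refine Finset.sum_congr rfl fun i _ => ?_
    simp only [Matrix.mulVec, dotProduct, Finset.mul_sum, Finset.sum_mul]
    refine Finset.sum_congr rfl fun j _ => ?_
    ring
  have hform : (z * f) ⬝ᵥ B.mulVec (z * f) = ∑ i, ∑ j, B i j * z i * z j * f i * f j := by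
    simp only [Matrix.mulVec, dotProduct, Finset.mul_sum, Pi.mul_apply]
    refine Finset.sum_congr rfl fun i _ => Finset.sum_congr rfl fun j _ => ?_
    ring
  rw [hform, hdiag, hsq, hswap]
  ring

/-- A symmetric real matrix with nonnegative off-diagonal entries, mapping a positive vector `z` to
a nonpositive vector with a negative entry at `c`, is negative definite as soon as every vector
whose ratio to `z` is constant along positive off-diagonal entries and vanishes at `c` is zero. -/
theorem dotProduct_mulVec_neg_of_pos_vector {ι : Type*} [Fintype ι] (B : Matrix ι ι ℝ)
    (hB : ∀ i j, B i j = B j i) (hoff : ∀ i j, i ≠ j → 0 ≤ B i j) (z : ι → ℝ) (hz : ∀ i, 0 < z i)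
    (hBz : ∀ i, B.mulVec z i ≤ 0) (c : ι) (hc : B.mulVec z c < 0)
    (hconn : ∀ f : ι → ℝ, f c = 0 → (∀ i j, i ≠ j → 0 < B i j → f i = f j) → f = 0)
    (x : ι → ℝ) (hx : x ≠ 0) : x ⬝ᵥ B.mulVec x < 0 := by
  obtain ⟨f, rfl⟩ : ∃ f : ι → ℝ, x = z * f :=
    ⟨fun i => x i / z i, funext fun i => by simp [mul_div_cancel₀ _ (hz i).ne']⟩
  have hdiag : ∀ i, z i * B.mulVec z i * f i ^ 2 ≤ 0 := fun i =>
    mul_nonpos_of_nonpos_of_nonneg (mul_nonpos_of_nonneg_of_nonpos (hz i).le (hBz i)) (sq_nonneg _)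
  have hedge : ∀ i j, 0 ≤ B i j * z i * z j * (f i - f j) ^ 2 := fun i j => by
    rcases eq_or_ne i j with rfl | h
    · simp
    · exact mul_nonneg (mul_nonneg (mul_nonneg (hoff i j h) (hz i).le) (hz j).le) (sq_nonneg _)
  have hD := Finset.sum_nonpos fun i (_ : i ∈ Finset.univ) => hdiag i
  have hE := Finset.sum_nonneg fun i (_ : i ∈ Finset.univ) =>
    Finset.sum_nonneg fun j (_ : j ∈ Finset.univ) => hedge i j
  rw [dotProduct_mulVec_mul_eq B hB]
  by_contra! hcon
  have hD0 : ∑ i, z i * B.mulVec z i * f i ^ 2 = 0 := by linarith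
  have hE0 : ∑ i, ∑ j, B i j * z i * z j * (f i - f j) ^ 2 = 0 := by linarith
  have hf : f = 0 := by
    refine hconn f ?_ fun i j hij hpos => ?_
    · have := (Finset.sum_eq_zero_iff_of_nonpos fun i _ => hdiag i).1 hD0 c (Finset.mem_univ _)
      simpa [(hz c).ne', hc.ne] using this
    · have h₁ := (Finset.sum_eq_zero_iff_of_nonneg fun i _ =>
        Finset.sum_nonneg fun j _ => hedge i j).1 hE0 i (Finset.mem_univ _)
      have h₂ := (Finset.sum_eq_zero_iff_of_nonneg fun j _ => hedge i j).1 h₁ j (Finset.mem_univ _)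
      have h₃ : f i - f j = 0 := by simpa [hpos.ne', (hz i).ne', (hz j).ne'] using h₂
      linarith
  exact hx (by simp [hf])

/-- A row of a tridiagonal matrix with unit off-diagonal entries, applied to a vector. -/
theorem sum_tridiagonal_row (n j : ℕ) (hj : j < n) (w : ℝ) (g : ℕ → ℝ) :
    ∑ l : Fin n, (if j = l.val then w else if j + 1 = l.val ∨ l.val + 1 = j then 1 else 0) *
        g l.val =
      w * g j + (if j + 1 < n then g (j + 1) else 0) + (if j = 0 then 0 else g (j - 1)) := by
  rw [Fin.sum_univ_eq_sum_range
    (fun l => (if j = l then w else if j + 1 = l ∨ l + 1 = j then 1 else 0) * g l) n]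
  have hsplit : ∀ l ∈ Finset.range n,
      (if j = l then w else if j + 1 = l ∨ l + 1 = j then 1 else 0) * g l =
        (if j = l then w * g l else 0) + (if j + 1 = l then g l else 0) +
          (if j - 1 = l then (if j = 0 then 0 else g l) else 0) := by
    intro l _
    split_ifs <;> first | omega | simp
  rw [Finset.sum_congr rfl hsplit]
  simp only [Finset.sum_add_distrib, Finset.sum_ite_eq, Finset.mem_range, hj, if_true,
    show j - 1 < n by omega]

/-- The values along a leg of the positive vector used to test negative definiteness. -/
noncomputable def legVec (M n : ℕ) : ℝ :=
  if n + 2 ≤ M then 10 * M - 11 - 10 * n else M + 7 - n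

/-- A positive vector which the plumbing matrix maps to minus the indicator of the centre. -/
noncomputable def plumbVec (k m : ℕ) : PlumbVtx k m → ℝ
  | none => m * (10 * (2 ^ k * m : ℕ) - 1)
  | some none => 10 * (2 ^ k * m : ℕ) - 1
  | some (some (_, j)) => m * legVec (2 ^ k * m) j.val

theorem legVec_pos {M n : ℕ} (hn : n < M + 7) : 0 < legVec M n := by
  unfold legVec
  split_ifs with h
  · have : (n : ℝ) + 2 ≤ M := by exact_mod_cast h
    linarith
  · have : (n : ℝ) < M + 7 := by exact_mod_cast hn
    linarith

theorem legVec_recurrence {M n : ℕ} (hM : 2 ≤ M) (hn : n < M + 7) :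
    (if n + 2 = M then -3 else -2) * legVec M n +
      (if n + 1 < M + 7 then legVec M (n + 1) else 0) +
      (if n = 0 then 10 * (M : ℝ) - 1 else legVec M (n - 1)) = 0 := by
  unfold legVec
  rcases n with _ | n
  · rcases eq_or_ne M 2 with rfl | h
    · norm_num
    · rw [if_neg (by omega), if_pos (by omega), if_pos (by omega), if_pos (by omega), if_pos rfl]
      push_cast; ring
  · rw [if_neg (Nat.succ_ne_zero n), Nat.add_sub_cancel]
    have hcast : ∀ a b : ℕ, a = b → (a : ℝ) = b := fun a b h => by rw [h]
    split_ifs <;> first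
      | omega
      | (push_cast; ring1)
      | (have := hcast (n + 3) M (by omega); push_cast at *; linarith)
      | (have := hcast (n + 2) M (by omega); push_cast at *; linarith)
      | (have := hcast (n + 1 + 1) (M + 7) (by omega); push_cast at *; linarith)

theorem plumbMat_symm (k m : ℕ) (x y : PlumbVtx k m) : plumbMat k m x y = plumbMat k m y x := by
  rcases eq_or_ne x y with rfl | h
  · rfl
  · have hadj : plumbAdj k m x y = plumbAdj k m y x := by
      rcases x with _ | _ | ⟨i, j⟩ <;> rcases y with _ | _ | ⟨i', j'⟩ <;>
        simp [plumbAdj, Bool.or_comm, Bool.beq_comm]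
    simp [plumbMat, h, h.symm, hadj]

theorem plumbMat_of_ne {k m : ℕ} {x y : PlumbVtx k m} (h : x ≠ y) :
    plumbMat k m x y = if plumbAdj k m x y then 1 else 0 := by
  simp [plumbMat, h]

theorem mulVec_plumbVec_center {k m : ℕ} (hM : 2 ≤ 2 ^ k * m) :
    ((plumbMat k m).map (fun a : ℤ => (a : ℝ))).mulVec (plumbVec k m) none = -1 := by
  have hcenter : (plumbMat k m none none : ℝ) = -2 ^ k := by
    simp [plumbMat, plumbWt]
  have hside : (plumbMat k m none (some none) : ℝ) = 1 := by
    simp [plumbMat, plumbAdj]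
  have hleg : ∀ (i : Fin (2 ^ k)) (j : Fin (2 ^ k * m + 7)),
      (plumbMat k m none (some (some (i, j))) : ℝ) = if j.val = 0 then 1 else 0 := by
    simp [plumbMat, plumbAdj]
  have hsum : ∑ j : Fin (2 ^ k * m + 7),
      (if j.val = 0 then (1 : ℝ) else 0) * (m * legVec (2 ^ k * m) j.val) =
        m * (10 * (2 ^ k * m : ℕ) - 11) := by
    rw [Finset.sum_eq_single ⟨0, by omega⟩
      (fun j _ hj => by rw [if_neg fun h => hj (Fin.ext h), zero_mul])
      (fun h => absurd (Finset.mem_univ _) h)]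
    simp only [if_true, legVec, zero_add, if_pos hM, Nat.cast_zero]
    ring
  simp only [Matrix.mulVec, dotProduct, Fintype.sum_option, Fintype.sum_prod_type,
    Matrix.map_apply, hcenter, hside, hleg, plumbVec, hsum, Finset.sum_const, Finset.card_univ,
    Fintype.card_fin, nsmul_eq_mul]
  push_cast
  ring

theorem mulVec_plumbVec_side (k m : ℕ) :
    ((plumbMat k m).map (fun a : ℤ => (a : ℝ))).mulVec (plumbVec k m) (some none) = 0 := by
  simp [Matrix.mulVec, dotProduct, Fintype.sum_option, plumbMat, plumbVec, plumbAdj,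
    plumbWt]

theorem mulVec_plumbVec_leg {k m : ℕ} (hM : 2 ≤ 2 ^ k * m) (i : Fin (2 ^ k))
    (j : Fin (2 ^ k * m + 7)) :
    ((plumbMat k m).map (fun a : ℤ => (a : ℝ))).mulVec (plumbVec k m) (some (some (i, j))) = 0 := by
  have hrow : ∀ i' : Fin (2 ^ k), ∀ j' : Fin (2 ^ k * m + 7),
      (plumbMat k m (some (some (i, j))) (some (some (i', j'))) : ℝ) =
        if i = i' then (if j.val = j'.val then (if j.val + 2 = 2 ^ k * m then -3 else -2) else
          if j.val + 1 = j'.val ∨ j'.val + 1 = j.val then 1 else 0) else 0 := by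
    intro i' j'
    by_cases hi : i = i' <;> by_cases hj : j = j' <;>
      simp [plumbMat, plumbAdj, plumbWt, hi, hj] <;> simp_all [Fin.ext_iff]
  have hcenter : (plumbMat k m (some (some (i, j))) none : ℝ) = if j.val = 0 then 1 else 0 := by
    simp [plumbMat, plumbAdj]
  have hside : (plumbMat k m (some (some (i, j))) (some none) : ℝ) = 0 := by
    simp [plumbMat, plumbAdj]
  have hsum := sum_tridiagonal_row (2 ^ k * m + 7) j.val j.isLt
    (if j.val + 2 = 2 ^ k * m then -3 else -2) fun n => m * legVec (2 ^ k * m) n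
  have hrec := legVec_recurrence hM j.isLt
  simp only [Matrix.mulVec, dotProduct, Fintype.sum_option, Fintype.sum_prod_type,
    Matrix.map_apply, hrow, hcenter, hside, plumbVec]
  rw [Finset.sum_eq_single i (fun i' _ hi => by simp [hi.symm]) (by simp)]
  simp only [if_true]
  rw [hsum]
  split_ifs at hrec ⊢ <;> linear_combination (m : ℝ) * hrec

/-- For `k ≥ 1` and odd `m ≥ 1`, the plumbing matrix `A(k,m)` is negative
definite: `xᵀAx < 0` for every nonzero real vector `x`. -/
theorem stmt11 (k m : ℕ) (hk : 1 ≤ k) (hm : 1 ≤ m) (hmodd : Odd m)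
    (x : PlumbVtx k m → ℝ) (hx : x ≠ 0) :
    x ⬝ᵥ ((plumbMat k m).map (fun a : ℤ => (a : ℝ))).mulVec x < 0 := by
  have hM : 2 ≤ 2 ^ k * m := by
    calc 2 = 2 ^ 1 * 1 := rfl
      _ ≤ 2 ^ k * m := Nat.mul_le_mul (Nat.pow_le_pow_right two_pos hk) hm
  have hm0 : (0 : ℝ) < m := by exact_mod_cast hm
  have hM0 : (0 : ℝ) < 10 * (2 ^ k * m : ℕ) - 1 := by
    have : (2 : ℝ) ≤ (2 ^ k * m : ℕ) := by exact_mod_cast hM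
    linarith
  refine dotProduct_mulVec_neg_of_pos_vector _ (fun x y => ?_) (fun x y hxy => ?_) (plumbVec k m)
    ?_ ?_ none ?_ (fun f hf hadj => ?_) x hx
  · simp [plumbMat_symm k m x y]
  · rw [Matrix.map_apply, plumbMat_of_ne hxy]
    split_ifs <;> simp
  · rintro (_ | _ | ⟨i, j⟩)
    · exact mul_pos hm0 hM0
    · exact hM0
    · exact mul_pos hm0 (legVec_pos j.isLt)
  · rintro (_ | _ | ⟨i, j⟩)
    · rw [mulVec_plumbVec_center hM]; norm_num
    · exact (mulVec_plumbVec_side k m).le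
    · exact (mulVec_plumbVec_leg hM i j).le
  · rw [mulVec_plumbVec_center hM]; norm_num
  · have hstep : ∀ x y, x ≠ y → plumbAdj k m x y = true → f x = f y := fun x y hxy h =>
      hadj x y hxy (by simp [plumbMat_of_ne hxy, h])
    have hleg : ∀ (i : Fin (2 ^ k)) (n : ℕ) (hn : n < 2 ^ k * m + 7),
        f (some (some (i, ⟨n, hn⟩))) = 0 := by
      intro i n
      induction n with
      | zero => exact fun hn => (hstep _ none (by simp) (by simp [plumbAdj])).trans hf
      | succ n ih =>
        exact fun hn => (hstep _ (some (some (i, ⟨n, by omega⟩))) (by simp)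
          (by simp [plumbAdj])).trans (ih _)
    funext v
    rcases v with _ | _ | ⟨i, j⟩
    · exact hf
    · exact (hstep _ none (by simp) rfl).trans hf
    · exact hleg i j.val j.isLt
end

section
/- Fix integers k ≥ 1 and m ≥ 1 with m odd, and let A = A(k,m) be the plumbing matrix of the graph Γ(k,m) described in the context, of size N = 2 + 2^k·(2^k·m + 7). Let w ∈ ℤ^N be the vector whose coordinate is 1 at the central vertex c and at each vertex v_{i,j} with j even and 2 ≤ j ≤ 2^k·m − 2, and 0 at all other vertices. Then: (i) w is characteristic for A, i.e. for every vertex x one has (Aw)_x ≡ A_{xx} (mod 2); (ii) w is the unique vector with all coordinates in {0,1} having property (i); and (iii) wᵀAw = 2^k − 2^{2k}·m. -/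
open scoped Matrix

/-- The spherical Wu class `w`: coordinate `1` at the central vertex `c` and at
each vertex `v_{i,j}` with `j` even and `2 ≤ j ≤ 2^k·m − 2`, and `0` elsewhere. -/
def plumbW (k m : ℕ) : PlumbVtx k m → ℤ
  | none => 1
  | some none => 0
  | some (some (_, j)) =>
      if (j.val + 1) % 2 = 0 ∧ 2 ≤ j.val + 1 ∧ j.val + 1 ≤ 2 ^ k * m - 2 then 1 else 0

/-- The values of `f` along the `i`-th leg, indexed by `ℕ`: `f c` at `0`, `f v_{i,n}` at
`1 ≤ n ≤ 2^k·m + 7`, and `0` beyond the end of the leg. -/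
def legVal {k m : ℕ} (f : PlumbVtx k m → ℤ) (i : Fin (2 ^ k)) : ℕ → ℤ
  | 0 => f none
  | n + 1 => if h : n < 2 ^ k * m + 7 then f (some (some (i, ⟨n, h⟩))) else 0

lemma legVal_succ {k m : ℕ} (f : PlumbVtx k m → ℤ) (i : Fin (2 ^ k))
    (j : Fin (2 ^ k * m + 7)) : legVal f i (j.val + 1) = f (some (some (i, j))) := by
  simp [legVal]

lemma plumbMat_mulVec_center {k m : ℕ} (f : PlumbVtx k m → ℤ) :
    (plumbMat k m).mulVec f none =
      -(2 ^ k : ℤ) * f none + f (some none) + ∑ i, legVal f i 1 := by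
  have h : ∀ i : Fin (2 ^ k), ∑ j : Fin (2 ^ k * m + 7),
      plumbMat k m none (some (some (i, j))) * f (some (some (i, j))) = legVal f i 1 := by
    intro i
    rw [Finset.sum_eq_single (⟨0, by omega⟩ : Fin (2 ^ k * m + 7))]
    · simp [plumbMat, plumbAdj, legVal]
    · intro j _ hj
      have : j.val ≠ 0 := fun h => hj (Fin.ext h)
      simp [plumbMat, plumbAdj, this]
    · simp
  simp only [Matrix.mulVec, dotProduct, Fintype.sum_option, Fintype.sum_prod_type, h]
  simp [plumbMat, plumbAdj, plumbWt]
  ring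

lemma plumbMat_mulVec_u {k m : ℕ} (f : PlumbVtx k m → ℤ) :
    (plumbMat k m).mulVec f (some none) = -(m : ℤ) * f (some none) + f none := by
  simp only [Matrix.mulVec, dotProduct, Fintype.sum_option]
  simp [plumbMat, plumbAdj, plumbWt]
  ring

lemma sum_range_tridiagonal (g : ℕ → ℤ) (L j : ℕ) (c : ℤ) (hj : j < L) (hg : g (L + 1) = 0) :
    ∑ t ∈ Finset.range L,
        (if j = t then c else if j + 1 = t ∨ t + 1 = j then 1 else 0) * g (t + 1) =
      c * g (j + 1) + (if j = 0 then 0 else g j) + g (j + 2) := by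
  have h : ∀ t, (if j = t then c else if j + 1 = t ∨ t + 1 = j then 1 else 0) * g (t + 1) =
      (if j = t then c * g (j + 1) else 0) + (if j - 1 = t then if j = 0 then 0 else g j else 0)
        + (if j + 1 = t then g (j + 2) else 0) := by
    intro t
    rcases lt_trichotomy (j + 1) (t + 1) with h | h | h
    · by_cases h' : j + 1 = t
      · subst h'; simp
      · have h1 : j ≠ t := by omega
        have h2 : t + 1 ≠ j := by omega
        have h3 : j - 1 ≠ t := by omega
        simp [h1, h2, h3, h']
    · obtain rfl : j = t := by omega
      by_cases h0 : j = 0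
      · simp [h0]
      · have h3 : j - 1 ≠ j := by omega
        simp [h3]
    · have h1 : j ≠ t := by omega
      have h2 : j + 1 ≠ t := by omega
      have h0 : j ≠ 0 := by omega
      by_cases h' : t + 1 = j
      · subst h'
        have h3 : t + 1 + 1 ≠ t := by omega
        simp [h3]
      · have h3 : j - 1 ≠ t := by omega
        simp [h1, h2, h3, h']
  simp only [h, Finset.sum_add_distrib, Finset.sum_ite_eq, Finset.mem_range]
  rw [if_pos hj, if_pos (by omega)]
  by_cases hj' : j + 1 < L
  · simp [hj']
  · obtain rfl : L = j + 1 := by omega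
    simp [hg]

lemma plumbMat_mulVec_leg {k m : ℕ} (f : PlumbVtx k m → ℤ) (i : Fin (2 ^ k))
    (j : Fin (2 ^ k * m + 7)) :
    (plumbMat k m).mulVec f (some (some (i, j))) =
      (if j.val + 2 = 2 ^ k * m then -3 else -2) * legVal f i (j.val + 1)
        + legVal f i j.val + legVal f i (j.val + 2) := by
  have hsum : ∑ x : Fin (2 ^ k) × Fin (2 ^ k * m + 7),
      plumbMat k m (some (some (i, j))) (some (some x)) * f (some (some x)) =
      (if j.val + 2 = 2 ^ k * m then -3 else -2) * legVal f i (j.val + 1)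
        + (if j.val = 0 then 0 else legVal f i j.val) + legVal f i (j.val + 2) := by
    rw [← sum_range_tridiagonal (legVal f i) _ _ _ j.isLt (by simp [legVal]),
      Fintype.sum_prod_type, Finset.sum_eq_single i, Finset.sum_range]
    · refine Finset.sum_congr rfl fun t _ => ?_
      rw [legVal_succ]
      simp [plumbMat, plumbAdj, plumbWt, Fin.ext_iff]
    · intro i' _ hi'
      refine Finset.sum_eq_zero fun t _ => ?_
      simp [plumbMat, plumbAdj, hi'.symm]
    · simp
  have h0 : plumbMat k m (some (some (i, j))) none * f none =
      if j.val = 0 then legVal f i j.val else 0 := by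
    by_cases h : j.val = 0 <;> simp [plumbMat, plumbAdj, h, legVal]
  have hu : plumbMat k m (some (some (i, j))) (some none) = 0 := by
    simp [plumbMat, plumbAdj]
  simp only [Matrix.mulVec, dotProduct, Fintype.sum_option]
  rw [hsum, h0, hu]
  split_ifs <;> ring

lemma legVal_plumbW {k m : ℕ} (h : 2 ≤ 2 ^ k * m) (i : Fin (2 ^ k)) (n : ℕ) :
    legVal (plumbW k m) i n = if n % 2 = 0 ∧ n + 2 ≤ 2 ^ k * m then 1 else 0 := by
  cases n with
  | zero => simp [legVal, plumbW, h]
  | succ n =>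
    simp only [legVal, plumbW]
    split_ifs <;> first | rfl | omega

lemma sum_range_even_indicator (a n : ℕ) :
    ∑ t ∈ Finset.range n, (if (t + 1) % 2 = 0 ∧ t + 1 ≤ 2 * a then (1 : ℤ) else 0) =
      (min (n / 2) a : ℕ) := by
  induction n with
  | zero => simp
  | succ n ih =>
    rw [Finset.sum_range_succ, ih]
    split_ifs <;> omega

/-- Solutions modulo 2 of the leg equations, where the only odd weight sits at `2a - 1`. -/
lemma leg_kernel_mod_two (g : ℕ → ℤ) (a : ℕ) (ha : 1 ≤ a) (hend : g (2 * a + 8) = 0)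
    (hrow : ∀ j < 2 * a + 7,
      2 ∣ (if j + 2 = 2 * a then -3 else -2) * g (j + 1) + g j + g (j + 2)) :
    2 ∣ g 1 - g 0 ∧ (2 ∣ g 0 → ∀ n ≤ 2 * a + 7, 2 ∣ g n) := by
  obtain ⟨b, rfl⟩ : ∃ b, a = b + 1 := ⟨a - 1, by omega⟩
  have hodd := hrow (2 * b) (by omega)
  rw [if_pos (by ring)] at hodd
  have heven : ∀ j < 2 * b + 9, j ≠ 2 * b → 2 ∣ g j + g (j + 2) := by
    intro j hj hne
    have := hrow j (by omega)
    rw [if_neg (by omega)] at this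
    omega
  have e1 := heven (2 * b + 1) (by omega) (by omega)
  have e2 := heven (2 * b + 2) (by omega) (by omega)
  have e3 := heven (2 * b + 3) (by omega) (by omega)
  have e4 := heven (2 * b + 4) (by omega) (by omega)
  have e5 := heven (2 * b + 5) (by omega) (by omega)
  have e6 := heven (2 * b + 6) (by omega) (by omega)
  have e7 := heven (2 * b + 7) (by omega) (by omega)
  have e8 := heven (2 * b + 8) (by omega) (by omega)
  have e9 : g (2 * b + 10) = 0 := hend
  simp only [add_assoc, Nat.reduceAdd] at e1 e2 e3 e4 e5 e6 e7 e8
  have hdown : ∀ s ≤ 2 * b, 2 ∣ g (2 * b - s) - g (2 * b + 1) ∧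
      2 ∣ g (2 * b - s + 1) - g (2 * b + 1) := by
    intro s
    induction s with
    | zero => intro _; constructor <;> simp; omega
    | succ s ih =>
      intro hs
      obtain ⟨h1, h2⟩ := ih (by omega)
      have h := heven (2 * b - (s + 1)) (by omega) (by omega)
      rw [show 2 * b - (s + 1) + 2 = 2 * b - s + 1 by omega] at h
      rw [show 2 * b - (s + 1) + 1 = 2 * b - s by omega]
      omega
  have h0 := hdown (2 * b) le_rfl
  simp only [Nat.sub_self, zero_add] at h0
  refine ⟨by omega, fun hg n hn => ?_⟩
  by_cases hnb : n ≤ 2 * b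
  · have := (hdown (2 * b - n) (by omega)).1
    rw [show 2 * b - (2 * b - n) = n by omega] at this
    omega
  · obtain ⟨r, rfl⟩ : ∃ r, n = 2 * b + r := ⟨n - 2 * b, by omega⟩
    have : r ≤ 9 := by omega
    interval_cases r <;> omega

/-- The plumbing matrix is injective modulo 2. -/
lemma two_dvd_of_two_dvd_plumbMat_mulVec {k m : ℕ} (hk : 1 ≤ k) (hm : Odd m)
    (d : PlumbVtx k m → ℤ) (hd : ∀ x, 2 ∣ (plumbMat k m).mulVec d x) (x : PlumbVtx k m) :
    2 ∣ d x := by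
  obtain ⟨a, ha⟩ : 2 ∣ 2 ^ k * m := (dvd_pow_self 2 (by omega)).mul_right m
  have ha1 : 1 ≤ a := by
    have : 0 < 2 ^ k * m := Nat.mul_pos (by positivity) hm.pos
    omega
  have hleg (i : Fin (2 ^ k)) := leg_kernel_mod_two (legVal d i) a ha1
    (by simp [legVal, ha])
    (fun j hj => by
      have := hd (some (some (i, ⟨j, by omega⟩)))
      rw [plumbMat_mulVec_leg] at this
      simpa only [ha] using this)
  have hk2 : (2 : ℤ) ∣ 2 ^ k := dvd_pow_self 2 (by omega)
  have hsum : 2 ∣ ∑ i, legVal d i 1 := by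
    have h1 : 2 ∣ ∑ i : Fin (2 ^ k), (legVal d i 1 - d none) :=
      Finset.dvd_sum fun i _ => (hleg i).1
    rw [Finset.sum_sub_distrib] at h1
    refine (dvd_sub_left ?_).1 h1
    simpa using hk2.mul_right (d none)
  have hu : 2 ∣ d (some none) := by
    have h := hd none
    rw [plumbMat_mulVec_center, dvd_add_left hsum] at h
    exact (dvd_add_right (hk2.neg_right.mul_right _)).1 h
  have hc : 2 ∣ d none := by
    have h := hd (some none)
    rw [plumbMat_mulVec_u] at h
    exact (dvd_add_right (hu.mul_left _)).1 h
  match x with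
  | none => exact hc
  | some none => exact hu
  | some (some (i, j)) =>
    rw [← legVal_succ d]
    exact (hleg i).2 hc _ (by omega)

lemma plumbMat_mulVec_plumbW_center {k m : ℕ} (h : 2 ≤ 2 ^ k * m) :
    (plumbMat k m).mulVec (plumbW k m) none = -(2 ^ k : ℤ) := by
  rw [plumbMat_mulVec_center]
  simp [legVal_plumbW h, plumbW]

lemma plumbMat_mulVec_plumbW_modEq {k m : ℕ} (hk : 1 ≤ k) (hm : Odd m) (x : PlumbVtx k m) :
    (plumbMat k m).mulVec (plumbW k m) x ≡ plumbMat k m x x [ZMOD 2] := by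
  obtain ⟨a, ha⟩ : 2 ∣ 2 ^ k * m := (dvd_pow_self 2 (by omega)).mul_right m
  have hM : 2 ≤ 2 ^ k * m := by
    have : 0 < 2 ^ k * m := Nat.mul_pos (by positivity) hm.pos
    omega
  match x with
  | none =>
    rw [plumbMat_mulVec_plumbW_center hM]
    simp [plumbMat, plumbWt, Int.ModEq.refl]
  | some none =>
    obtain ⟨b, rfl⟩ := hm
    rw [plumbMat_mulVec_u]
    simp only [plumbMat, plumbWt, plumbW, Matrix.of_apply, if_true, Int.ModEq]
    push_cast
    omega
  | some (some (i, j)) =>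
    rw [plumbMat_mulVec_leg]
    simp only [legVal_plumbW hM, plumbMat, plumbWt, Matrix.of_apply, if_true, Int.ModEq, ha]
    split_ifs <;> omega

lemma plumbW_dotProduct_mulVec {k m : ℕ} (hk : 1 ≤ k) (hm : 1 ≤ m) :
    plumbW k m ⬝ᵥ (plumbMat k m).mulVec (plumbW k m) = 2 ^ k - 2 ^ (2 * k) * (m : ℤ) := by
  obtain ⟨a, ha⟩ : 2 ∣ 2 ^ k * m := (dvd_pow_self 2 (by omega)).mul_right m
  have hM : 2 ≤ 2 ^ k * m := by
    have : 0 < 2 ^ k * m := Nat.mul_pos (by positivity) hm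
    omega
  have hleg (i : Fin (2 ^ k)) : ∑ j : Fin (2 ^ k * m + 7),
      plumbW k m (some (some (i, j))) *
        (plumbMat k m).mulVec (plumbW k m) (some (some (i, j))) = 2 - 2 ^ k * (m : ℤ) := by
    have hterm (j : Fin (2 ^ k * m + 7)) : plumbW k m (some (some (i, j))) *
        (plumbMat k m).mulVec (plumbW k m) (some (some (i, j))) =
        -2 * if (j.val + 1) % 2 = 0 ∧ j.val + 1 ≤ 2 * (a - 1) then (1 : ℤ) else 0 := by
      rw [plumbMat_mulVec_leg, ← legVal_succ (plumbW k m)]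
      simp only [legVal_plumbW hM, ha]
      split_ifs <;> omega
    have hcast : (2 ^ k * (m : ℤ)) = 2 * a := by exact_mod_cast ha
    rw [Finset.sum_congr rfl fun j _ => hterm j, ← Finset.mul_sum,
      ← Finset.sum_range (fun t => if (t + 1) % 2 = 0 ∧ t + 1 ≤ 2 * (a - 1) then (1 : ℤ) else 0),
      sum_range_even_indicator, hcast, ha]
    omega
  simp only [dotProduct, Fintype.sum_option, Fintype.sum_prod_type, hleg,
    plumbMat_mulVec_plumbW_center hM]
  simp [plumbW]
  ring

/-- For `k ≥ 1` and odd `m ≥ 1`: (i) `w` is characteristic for `A(k,m)`, i.e.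
`(Aw)_x ≡ A_{xx} (mod 2)` for every vertex `x`; (ii) `w` is the unique `{0,1}`-vector
with this property; (iii) `wᵀAw = 2^k − 2^{2k}·m`. -/
theorem stmt12 (k m : ℕ) (hk : 1 ≤ k) (hm : 1 ≤ m) (hmodd : Odd m) :
    (∀ x : PlumbVtx k m,
      ((plumbMat k m).mulVec (plumbW k m)) x ≡ plumbMat k m x x [ZMOD 2]) ∧
    (∀ w' : PlumbVtx k m → ℤ, (∀ x, w' x = 0 ∨ w' x = 1) →
      (∀ x : PlumbVtx k m,
        ((plumbMat k m).mulVec w') x ≡ plumbMat k m x x [ZMOD 2]) →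
      w' = plumbW k m) ∧
    plumbW k m ⬝ᵥ (plumbMat k m).mulVec (plumbW k m) = 2 ^ k - 2 ^ (2 * k) * (m : ℤ) := by
  refine ⟨plumbMat_mulVec_plumbW_modEq hk hmodd, fun w' h01 hw' => ?_,
    plumbW_dotProduct_mulVec hk hm⟩
  funext x
  have hdiff : 2 ∣ (w' - plumbW k m) x := by
    refine two_dvd_of_two_dvd_plumbMat_mulVec hk hmodd _ (fun y => ?_) x
    rw [Matrix.mulVec_sub]
    exact ((plumbMat_mulVec_plumbW_modEq hk hmodd y).trans (hw' y).symm).dvd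
  have hW : plumbW k m x = 0 ∨ plumbW k m x = 1 := by
    unfold plumbW
    split <;> first | (split_ifs <;> simp) | simp
  have hx := h01 x
  rw [Pi.sub_apply] at hdiff
  omega
end
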